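/- For every (i,t) ∈ A, the inequality x_{2n−2,i,t} ≤ y_{t,i,t} is facet-defining for Ptt(n). -/

import Mathlib

open Finset

attribute [local instance] Classical.propDecidable

namespace TTP

/-- `(k,i,j)` is a valid match index: slot `k ∈ S = {1,…,2n-2}`, home venue `i` and
away team `j` are distinct elements of `V = {1,…,n}`. -/
def IsMatch (n : ℕ) (m : ℕ × ℕ × ℕ) : Prop :=
  1 ≤ m.1 ∧ m.1 ≤ 2 * n - 2 ∧ 1 ≤ m.2.1 ∧ m.2.1 ≤ n ∧ 1 ≤ m.2.2 ∧ m.2.2 ≤ n ∧ m.2.1 ≠ m.2.2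

/-- `(t,i,j)` is a valid travel index: `t ∈ V` and `(i,j) ∈ A`. -/
def IsTravelIdx (n : ℕ) (p : ℕ × ℕ × ℕ) : Prop :=
  1 ≤ p.1 ∧ p.1 ≤ n ∧ 1 ≤ p.2.1 ∧ p.2.1 ≤ n ∧ 1 ≤ p.2.2 ∧ p.2.2 ≤ n ∧ p.2.1 ≠ p.2.2

/-- A (double round-robin) tournament: a set of matches such that in every slot every team
plays exactly once, and every ordered pair of distinct teams meets exactly once. -/
structure IsTournament (n : ℕ) (T : Set (ℕ × ℕ × ℕ)) : Prop where
  subset : ∀ m ∈ T, IsMatch n m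
  slot_team : ∀ k, 1 ≤ k → k ≤ 2 * n - 2 → ∀ t, 1 ≤ t → t ≤ n →
      ∃! m : ℕ × ℕ × ℕ, m ∈ T ∧ m.1 = k ∧ (t = m.2.1 ∨ t = m.2.2)
  pair : ∀ i j, 1 ≤ i → i ≤ n → 1 ≤ j → j ≤ n → i ≠ j → ∃! k : ℕ, (k, i, j) ∈ T

/-- The venue of team `t` in slot `k`: the home venue of the (unique) match of `t` in
slot `k`, and `t` itself if `t` has no match in slot `k` (in particular in the artificial
slots `0` and `2n-1`). -/
noncomputable def venue (T : Set (ℕ × ℕ × ℕ)) (t k : ℕ) : ℕ :=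
  if h : ∃ i, ∃ j, (k, i, j) ∈ T ∧ (t = i ∨ t = j) then h.choose else t

/-- The travel vector `ψ(T)`: `travel n T (t,i,j) = 1` iff for some `0 ≤ k ≤ 2n-2` team `t`
has venue `i` in slot `k` and venue `j` in slot `k+1`. -/
noncomputable def travel (n : ℕ) (T : Set (ℕ × ℕ × ℕ)) (p : ℕ × ℕ × ℕ) : ℝ :=
  if ∃ k, k ≤ 2 * n - 2 ∧ venue T p.1 k = p.2.1 ∧ venue T p.1 (k + 1) = p.2.2 then 1 else 0

/-- The play vector `χ(T)`: characteristic vector of `T`. -/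
noncomputable def play (T : Set (ℕ × ℕ × ℕ)) (m : ℕ × ℕ × ℕ) : ℝ :=
  if m ∈ T then 1 else 0

/-- The ambient space `ℝ^M × ℝ^{V×A}`. -/
abbrev Pt (n : ℕ) :=
  ({m : ℕ × ℕ × ℕ // IsMatch n m} → ℝ) × ({p : ℕ × ℕ × ℕ // IsTravelIdx n p} → ℝ)

/-- The play coordinate `x_{k,i,j}` of a point (0 at invalid indices). -/
noncomputable def xval {n : ℕ} (z : Pt n) (k i j : ℕ) : ℝ :=
  if h : IsMatch n (k, i, j) then z.1 ⟨(k, i, j), h⟩ else 0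

/-- The travel coordinate `y_{t,i,j}` of a point (0 at invalid indices). -/
noncomputable def yval {n : ℕ} (z : Pt n) (t i j : ℕ) : ℝ :=
  if h : IsTravelIdx n (t, i, j) then z.2 ⟨(t, i, j), h⟩ else 0

/-- The unconstrained traveling tournament polytope `Ptt(n)`:
the convex hull of all pairs `(χ(T), y)` with `T` a tournament and `y ∈ {0,1}^{V×A}`,
`y ≥ ψ(T)` componentwise. -/
def Ptt (n : ℕ) : Set (Pt n) :=
  convexHull ℝ { z : Pt n | ∃ T : Set (ℕ × ℕ × ℕ), IsTournament n T ∧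
    (∀ m : {m : ℕ × ℕ × ℕ // IsMatch n m}, z.1 m = play T m.1) ∧
    (∀ p : {p : ℕ × ℕ × ℕ // IsTravelIdx n p}, z.2 p = 0 ∨ z.2 p = 1) ∧
    (∀ p : {p : ℕ × ℕ × ℕ // IsTravelIdx n p}, travel n T p.1 ≤ z.2 p) }

/-- Dimension of the affine hull of a set. -/
noncomputable def adim {n : ℕ} (s : Set (Pt n)) : ℕ :=
  Module.finrank ℝ (affineSpan ℝ s).direction

/-- A valid inequality `f z ≤ γ` is facet-defining for `Ptt(n)`:
it holds on `Ptt(n)` and its face has dimension `dim Ptt(n) - 1`. -/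
def IsFacetLE {n : ℕ} (f : Pt n → ℝ) (γ : ℝ) : Prop :=
  (∀ z ∈ Ptt n, f z ≤ γ) ∧ adim {z ∈ Ptt n | f z = γ} + 1 = adim (Ptt n)

/-- A valid inequality `f z ≥ γ` is facet-defining for `Ptt(n)`:
it holds on `Ptt(n)` and its face has dimension `dim Ptt(n) - 1`. -/
def IsFacetGE {n : ℕ} (f : Pt n → ℝ) (γ : ℝ) : Prop :=
  (∀ z ∈ Ptt n, γ ≤ f z) ∧ adim {z ∈ Ptt n | f z = γ} + 1 = adim (Ptt n)


section

variable {n : ℕ} {T : Set (ℕ × ℕ × ℕ)}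

/-! ### Basic facts about tournaments -/

namespace IsTournament

lemma match_unique (hT : IsTournament n T) {k a b c d s : ℕ} (h₁ : (k, a, b) ∈ T)
    (h₂ : (k, c, d) ∈ T) (hab : s = a ∨ s = b) (hcd : s = c ∨ s = d) : a = c ∧ b = d := by
  obtain ⟨hk, hk', ha, ha', hb, hb', -⟩ := hT.subset _ h₁
  have hs : 1 ≤ s ∧ s ≤ n := by rcases hab with rfl | rfl <;> exact ⟨by assumption, by assumption⟩
  have := (hT.slot_team k hk hk' s hs.1 hs.2).unique ⟨h₁, rfl, hab⟩ ⟨h₂, rfl, hcd⟩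
  simpa using this

lemma slot_unique (hT : IsTournament n T) {k l a b : ℕ} (h₁ : (k, a, b) ∈ T)
    (h₂ : (l, a, b) ∈ T) : k = l := by
  obtain ⟨-, -, ha, ha', hb, hb', hab⟩ := hT.subset _ h₁
  exact (hT.pair a b ha ha' hb hb' hab).unique h₁ h₂

lemma exists_slot (hT : IsTournament n T) {a b : ℕ} (ha : 1 ≤ a ∧ a ≤ n) (hb : 1 ≤ b ∧ b ≤ n)
    (hab : a ≠ b) : ∃ k, 1 ≤ k ∧ k ≤ 2 * n - 2 ∧ (k, a, b) ∈ T := by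
  obtain ⟨k, hk, -⟩ := hT.pair a b ha.1 ha.2 hb.1 hb.2 hab
  exact ⟨k, (hT.subset _ hk).1, (hT.subset _ hk).2.1, hk⟩

lemma venue_eq (hT : IsTournament n T) {k a b s : ℕ} (h : (k, a, b) ∈ T) (hs : s = a ∨ s = b) :
    venue T s k = a := by
  have hex : ∃ i, ∃ j, (k, i, j) ∈ T ∧ (s = i ∨ s = j) := ⟨a, b, h, hs⟩
  rw [venue, dif_pos hex]
  obtain ⟨j, hj, hsj⟩ := hex.choose_spec
  exact (hT.match_unique hj h hsj hs).1

lemma venue_last (hT : IsTournament n T) (s : ℕ) : venue T s (2 * n - 2 + 1) = s := by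
  rw [venue, dif_neg]
  rintro ⟨i, j, h, -⟩
  have : 2 * n - 2 + 1 ≤ 2 * n - 2 := (hT.subset _ h).2.1
  omega

end IsTournament

lemma mem_of_venue_eq {k a s : ℕ} (h : venue T s k = a) (ha : a ≠ s) : (k, a, s) ∈ T := by
  rw [venue] at h
  split_ifs at h with hex
  · obtain ⟨j, hj, hsj⟩ := hex.choose_spec
    rw [h] at hj hsj
    rcases hsj with rfl | rfl
    · exact absurd rfl ha
    · exact hj
  · exact absurd h.symm ha

namespace IsTournament

lemma travel_eq_zero_of_next (hT : IsTournament n T) {k a b s : ℕ} (h : (k, a, s) ∈ T)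
    (hb : venue T s (k + 1) ≠ b) : travel n T (s, a, b) = 0 := by
  rw [travel, if_neg]
  rintro ⟨l, -, h₁, h₂⟩
  have := hT.slot_unique (mem_of_venue_eq h₁ (hT.subset _ h).2.2.2.2.2.2) h
  subst this
  exact hb h₂

lemma travel_eq_zero_of_prev (hT : IsTournament n T) {k a b s : ℕ} (h : (k + 1, b, s) ∈ T)
    (ha : venue T s k ≠ a) : travel n T (s, a, b) = 0 := by
  rw [travel, if_neg]
  rintro ⟨l, -, h₁, h₂⟩
  have := hT.slot_unique (mem_of_venue_eq h₂ (hT.subset _ h).2.2.2.2.2.2) h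
  obtain rfl : l = k := by omega
  exact ha h₁

lemma travel_last (hT : IsTournament n T) {i t : ℕ} (h : (2 * n - 2, i, t) ∈ T) :
    travel n T (t, i, t) = 1 := by
  rw [travel, if_pos]
  exact ⟨2 * n - 2, le_rfl, hT.venue_eq h (.inr rfl), hT.venue_last t⟩

lemma exists_three_opponents (hn : 4 ≤ n) (s : ℕ) : ∃ a b c : ℕ,
    (1 ≤ a ∧ a ≤ n) ∧ (1 ≤ b ∧ b ≤ n) ∧ (1 ≤ c ∧ c ≤ n) ∧
    a ≠ s ∧ b ≠ s ∧ c ≠ s ∧ a ≠ b ∧ a ≠ c ∧ b ≠ c := by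
  by_cases h₁ : s = 1
  · exact ⟨2, 3, 4, by omega⟩
  by_cases h₂ : s = 2
  · exact ⟨1, 3, 4, by omega⟩
  by_cases h₃ : s = 3
  · exact ⟨1, 2, 4, by omega⟩
  exact ⟨1, 2, 3, by omega⟩

/-- A team has an away match outside any two given slots. -/
lemma exists_away (hT : IsTournament n T) (hn : 4 ≤ n) {s : ℕ} (hs : 1 ≤ s ∧ s ≤ n) (r₁ r₂ : ℕ) :
    ∃ k c, 1 ≤ k ∧ k ≤ 2 * n - 2 ∧ (k, c, s) ∈ T ∧ c ≠ s ∧ k ≠ r₁ ∧ k ≠ r₂ := by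
  obtain ⟨a, b, c, ha, hb, hc, has, hbs, hcs, hab, hac, hbc⟩ := exists_three_opponents hn s
  obtain ⟨ka, ha₁, ha₂, hka⟩ := hT.exists_slot ha hs has
  obtain ⟨kb, hb₁, hb₂, hkb⟩ := hT.exists_slot hb hs hbs
  obtain ⟨kc, hc₁, hc₂, hkc⟩ := hT.exists_slot hc hs hcs
  have h₁ : ka ≠ kb := by
    rintro rfl; exact hab (hT.match_unique (s := s) hka hkb (.inr rfl) (.inr rfl)).1
  have h₂ : ka ≠ kc := by
    rintro rfl; exact hac (hT.match_unique (s := s) hka hkc (.inr rfl) (.inr rfl)).1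
  have h₃ : kb ≠ kc := by
    rintro rfl; exact hbc (hT.match_unique (s := s) hkb hkc (.inr rfl) (.inr rfl)).1
  by_cases h : ka ≠ r₁ ∧ ka ≠ r₂
  · exact ⟨ka, a, ha₁, ha₂, hka, has, h⟩
  by_cases h' : kb ≠ r₁ ∧ kb ≠ r₂
  · exact ⟨kb, b, hb₁, hb₂, hkb, hbs, h'⟩
  exact ⟨kc, c, hc₁, hc₂, hkc, hcs, by omega⟩

/-- A team has a home match outside any two given slots. -/
lemma exists_home (hT : IsTournament n T) (hn : 4 ≤ n) {s : ℕ} (hs : 1 ≤ s ∧ s ≤ n) (r₁ r₂ : ℕ) :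
    ∃ k c, 1 ≤ k ∧ k ≤ 2 * n - 2 ∧ (k, s, c) ∈ T ∧ c ≠ s ∧ k ≠ r₁ ∧ k ≠ r₂ := by
  obtain ⟨a, b, c, ha, hb, hc, has, hbs, hcs, hab, hac, hbc⟩ := exists_three_opponents hn s
  obtain ⟨ka, ha₁, ha₂, hka⟩ := hT.exists_slot hs ha has.symm
  obtain ⟨kb, hb₁, hb₂, hkb⟩ := hT.exists_slot hs hb hbs.symm
  obtain ⟨kc, hc₁, hc₂, hkc⟩ := hT.exists_slot hs hc hcs.symm
  have h₁ : ka ≠ kb := by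
    rintro rfl; exact hab (hT.match_unique (s := s) hka hkb (.inl rfl) (.inl rfl)).2
  have h₂ : ka ≠ kc := by
    rintro rfl; exact hac (hT.match_unique (s := s) hka hkc (.inl rfl) (.inl rfl)).2
  have h₃ : kb ≠ kc := by
    rintro rfl; exact hbc (hT.match_unique (s := s) hkb hkc (.inl rfl) (.inl rfl)).2
  by_cases h : ka ≠ r₁ ∧ ka ≠ r₂
  · exact ⟨ka, a, ha₁, ha₂, hka, has, h⟩
  by_cases h' : kb ≠ r₁ ∧ kb ≠ r₂
  · exact ⟨kb, b, hb₁, hb₂, hkb, hbs, h'⟩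
  exact ⟨kc, c, hc₁, hc₂, hkc, hcs, by omega⟩

end IsTournament

/-! ### Permuting slots and exchanging home rights -/

/-- `σ` permutes the slots `1, …, m`. -/
def PermutesSlots (m : ℕ) (σ : Equiv.Perm ℕ) : Prop :=
  ∀ k, (1 ≤ σ k ∧ σ k ≤ m) ↔ (1 ≤ k ∧ k ≤ m)

/-- The tournament whose slot `k` carries the matches of slot `σ k` of `T`. -/
def reslot (σ : Equiv.Perm ℕ) (T : Set (ℕ × ℕ × ℕ)) : Set (ℕ × ℕ × ℕ) :=
  {m | (σ m.1, m.2) ∈ T}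

lemma permutesSlots_swap {m p q : ℕ} (hp : 1 ≤ p ∧ p ≤ m) (hq : 1 ≤ q ∧ q ≤ m) :
    PermutesSlots m (Equiv.swap p q) := by
  intro k
  rw [Equiv.swap_apply_def]
  split_ifs <;> simp_all

lemma exists_permutesSlots (m : ℕ) (l : List (ℕ × ℕ)) (h₁ : (l.map Prod.fst).Nodup)
    (h₂ : (l.map Prod.snd).Nodup)
    (h : ∀ x ∈ l, (1 ≤ x.1 ∧ x.1 ≤ m) ∧ (1 ≤ x.2 ∧ x.2 ≤ m)) :
    ∃ σ, PermutesSlots m σ ∧ ∀ x ∈ l, σ x.1 = x.2 := by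
  induction l with
  | nil => exact ⟨1, fun _ => Iff.rfl, by simp⟩
  | cons x l ih =>
    rw [List.map_cons, List.nodup_cons] at h₁ h₂
    obtain ⟨σ, hσ, hl⟩ := ih h₁.2 h₂.2 fun y hy => h y (List.mem_cons_of_mem _ hy)
    obtain ⟨hx₁, hx₂⟩ := h x List.mem_cons_self
    refine ⟨σ.trans (Equiv.swap (σ x.1) x.2), fun k => ?_, fun y hy => ?_⟩
    · exact (permutesSlots_swap ((hσ _).2 hx₁) hx₂ (σ k)).trans (hσ k)
    · rcases List.mem_cons.1 hy with rfl | hy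
      · simp
      · rw [Equiv.trans_apply, Equiv.swap_apply_of_ne_of_ne, hl y hy]
        · intro he
          exact h₁.1 (List.mem_map.2 ⟨y, hy, σ.injective he⟩)
        · intro he
          exact h₂.1 (List.mem_map.2 ⟨y, hy, (hl y hy).symm.trans he⟩)

lemma IsTournament.reslot (hT : IsTournament n T) {σ : Equiv.Perm ℕ}
    (hσ : PermutesSlots (2 * n - 2) σ) : IsTournament n (reslot σ T) where
  subset := by
    rintro ⟨k, i, j⟩ h
    obtain ⟨h₁, h₂, h₃⟩ := hT.subset _ h
    exact ⟨((hσ k).1 ⟨h₁, h₂⟩).1, ((hσ k).1 ⟨h₁, h₂⟩).2, h₃⟩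
  slot_team k hk hk' t ht ht' := by
    obtain ⟨hk₁, hk₂⟩ := (hσ k).2 ⟨hk, hk'⟩
    obtain ⟨⟨l, i, j⟩, ⟨hm, rfl, hij⟩, -⟩ := hT.slot_team (σ k) hk₁ hk₂ t ht ht'
    refine ⟨(k, i, j), ⟨hm, rfl, hij⟩, ?_⟩
    rintro ⟨l, a, b⟩ ⟨hm', rfl, hab⟩
    obtain ⟨rfl, rfl⟩ := hT.match_unique hm' hm hab hij
    rfl
  pair i j hi hi' hj hj' hij := by
    obtain ⟨k, hk, -⟩ := hT.pair i j hi hi' hj hj' hij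
    refine ⟨σ.symm k, by simpa [TTP.reslot] using hk, fun l hl => ?_⟩
    rw [Equiv.eq_symm_apply]
    exact hT.slot_unique hl hk

/-- Exchange the home rights in the two matches between `a` and `s`. -/
def flipPair (a s : ℕ) (T : Set (ℕ × ℕ × ℕ)) : Set (ℕ × ℕ × ℕ) :=
  {m | if (m.2.1 = a ∧ m.2.2 = s) ∨ (m.2.1 = s ∧ m.2.2 = a) then (m.1, m.2.2, m.2.1) ∈ T else m ∈ T}

lemma mem_flipPair {a s k i j : ℕ} : (k, i, j) ∈ flipPair a s T ↔
    if (i = a ∧ j = s) ∨ (i = s ∧ j = a) then (k, j, i) ∈ T else (k, i, j) ∈ T := Iff.rfl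

lemma IsTournament.flipPair (hT : IsTournament n T) (a s : ℕ) :
    IsTournament n (flipPair a s T) where
  subset := by
    rintro ⟨k, i, j⟩ h
    rw [mem_flipPair] at h
    split_ifs at h
    · obtain ⟨h₁, h₂, h₃, h₄, h₅, h₆, h₇⟩ := hT.subset _ h
      exact ⟨h₁, h₂, h₅, h₆, h₃, h₄, Ne.symm h₇⟩
    · exact hT.subset _ h
  slot_team k hk hk' t ht ht' := by
    obtain ⟨⟨l, i, j⟩, ⟨hm, rfl, hij⟩, -⟩ := hT.slot_team k hk hk' t ht ht'
    have key : ∀ c d, (l, c, d) ∈ TTP.flipPair a s T → (t = c ∨ t = d) →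
        (c = i ∧ d = j) ∨ (c = j ∧ d = i) := by
      intro c d h hcd
      rw [mem_flipPair] at h
      split_ifs at h
      · exact .inr (hT.match_unique h hm hcd.symm hij).symm
      · exact .inl (hT.match_unique h hm hcd hij)
    dsimp only at hij
    by_cases hc : (i = a ∧ j = s) ∨ (i = s ∧ j = a)
    · have hc' : (j = a ∧ i = s) ∨ (j = s ∧ i = a) := by tauto
      refine ⟨(l, j, i), ⟨by rw [mem_flipPair, if_pos hc']; exact hm, rfl, hij.symm⟩, ?_⟩
      rintro ⟨l', c, d⟩ ⟨hm', rfl, hcd⟩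
      rcases key c d hm' hcd with ⟨rfl, rfl⟩ | ⟨rfl, rfl⟩
      · rw [mem_flipPair, if_pos hc] at hm'
        have := hT.match_unique hm hm' hij hij.symm
        simp [this.1]
      · rfl
    · have hc' : ¬((j = a ∧ i = s) ∨ (j = s ∧ i = a)) := by tauto
      refine ⟨(l, i, j), ⟨by rw [mem_flipPair, if_neg hc]; exact hm, rfl, hij⟩, ?_⟩
      rintro ⟨l', c, d⟩ ⟨hm', rfl, hcd⟩
      rcases key c d hm' hcd with ⟨rfl, rfl⟩ | ⟨rfl, rfl⟩
      · rfl
      · rw [mem_flipPair, if_neg hc'] at hm'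
        have := hT.match_unique hm hm' hij hij.symm
        simp [this.1]
  pair i j hi hi' hj hj' hij := by
    simp only [mem_flipPair]
    split_ifs
    · exact hT.pair j i hj hj' hi hi' hij.symm
    · exact hT.pair i j hi hi' hj hj' hij

/-! ### Existence of tournaments -/

/-- The colour class of the pair `{i, j}` in the circle method, modulo `n - 1`. -/
def circleColor (n i j : ℕ) : ℕ :=
  if i = n then 2 * j else if j = n then 2 * i else i + j

/-- The double round-robin schedule obtained by mirroring the circle method. -/
def circleSchedule (n : ℕ) : Set (ℕ × ℕ × ℕ) :=
  {m | IsMatch n m ∧ circleColor n m.2.1 m.2.2 ≡ m.1 [MOD n - 1] ∧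
    (m.2.1 < m.2.2 ↔ m.1 ≤ n - 1)}

lemma circleColor_comm (n i j : ℕ) : circleColor n i j = circleColor n j i := by
  unfold circleColor
  split_ifs <;> omega

lemma eq_of_modEq_of_le {N a b : ℕ} (h : a ≡ b [MOD N]) (ha : 1 ≤ a ∧ a ≤ N)
    (hb : 1 ≤ b ∧ b ≤ N) : a = b := by
  rcases Nat.lt_or_ge a N with h₁ | h₁ <;> rcases Nat.lt_or_ge b N with h₂ | h₂
  · exact h.eq_of_lt_of_lt h₁ h₂
  · obtain rfl : b = N := by omega
    rw [Nat.ModEq, Nat.mod_eq_of_lt h₁, Nat.mod_self] at h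
    omega
  · obtain rfl : a = N := by omega
    rw [Nat.ModEq, Nat.mod_eq_of_lt h₂, Nat.mod_self] at h
    omega
  · omega

lemma exists_modEq_le {N : ℕ} (hN : 1 ≤ N) (c : ℕ) : ∃ k, (1 ≤ k ∧ k ≤ N) ∧ k ≡ c [MOD N] := by
  have := Nat.mod_lt c hN
  by_cases h : c % N = 0
  · exact ⟨N, by omega, by rw [Nat.ModEq, h, Nat.mod_self]⟩
  · exact ⟨c % N, by omega, Nat.mod_modEq c N⟩

lemma exists_opponent (hn : 4 ≤ n) (heven : Even n) (k : ℕ) {t : ℕ} (ht : 1 ≤ t ∧ t ≤ n) :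
    ∃ j, (1 ≤ j ∧ j ≤ n) ∧ t ≠ j ∧ circleColor n t j ≡ k [MOD n - 1] := by
  by_cases htn : t = n
  · obtain ⟨h, rfl⟩ := heven
    obtain ⟨j, hj, hjc⟩ := exists_modEq_le (N := h + h - 1) (by omega) (k * h)
    refine ⟨j, by omega, by omega, ?_⟩
    rw [circleColor, if_pos htn]
    refine (hjc.mul_left 2).trans ?_
    have : 2 * (k * h) = k + k * (h + h - 1) := by
      obtain ⟨h', rfl⟩ : ∃ h', h = h' + 1 := ⟨h - 1, by omega⟩
      have : h' + 1 + (h' + 1) - 1 = 2 * h' + 1 := by omega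
      rw [this]; ring
    rw [this]
    exact Nat.add_mul_mod_self_right _ _ _
  · obtain ⟨j, hj, hjc⟩ := exists_modEq_le (N := n - 1) (by omega) (k + t * (n - 1 - 1))
    have key : t + j ≡ k [MOD n - 1] := by
      refine (hjc.add_left t).trans ?_
      have : t + (k + t * (n - 1 - 1)) = k + t * (n - 1) := by
        obtain ⟨m, rfl⟩ : ∃ m, n = m + 2 := ⟨n - 2, by omega⟩
        have h₁ : m + 2 - 1 = m + 1 := by omega
        rw [h₁, Nat.add_sub_cancel]; ring
      rw [this]
      exact Nat.add_mul_mod_self_right _ _ _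
    by_cases htj : t = j
    · refine ⟨n, by omega, htn, ?_⟩
      rw [circleColor, if_neg htn, if_pos rfl, two_mul]
      simpa [← htj] using key
    · refine ⟨j, by omega, htj, ?_⟩
      rw [circleColor, if_neg htn, if_neg (by omega)]
      exact key

lemma opponent_unique (heven : Even n) {t j l : ℕ} (ht : 1 ≤ t ∧ t ≤ n) (hj : 1 ≤ j ∧ j ≤ n)
    (hl : 1 ≤ l ∧ l ≤ n) (htj : t ≠ j) (htl : t ≠ l)
    (h : circleColor n t j ≡ circleColor n t l [MOD n - 1]) : j = l := by
  unfold circleColor at h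
  have hodd : Nat.gcd (n - 1) 2 = 1 := by
    rw [← Nat.coprime_iff_gcd_eq_one, Nat.coprime_comm, Nat.coprime_two_left]
    exact Nat.Even.sub_odd (by omega) heven odd_one
  split_ifs at h with h₁ h₂ h₃ h₃
  · exact eq_of_modEq_of_le (h.cancel_left_of_coprime hodd) (by omega) (by omega)
  · omega
  · rw [two_mul] at h
    exact absurd (eq_of_modEq_of_le (h.add_left_cancel' t) (by omega) (by omega)) htl
  · rw [two_mul] at h
    exact absurd (eq_of_modEq_of_le (h.add_left_cancel' t) (by omega) (by omega)).symm htj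
  · exact eq_of_modEq_of_le (h.add_left_cancel' t) (by omega) (by omega)

lemma isTournament_circleSchedule (hn : 4 ≤ n) (heven : Even n) :
    IsTournament n (circleSchedule n) where
  subset _ h := h.1
  slot_team k hk hk' t ht ht' := by
    obtain ⟨j, hj, htj, hc⟩ := exists_opponent hn heven k ⟨ht, ht'⟩
    have key : ∀ a b, (k, a, b) ∈ circleSchedule n → (t = a ∨ t = b) →
        (a = t ∧ b = j) ∨ (a = j ∧ b = t) := by
      rintro a b ⟨⟨-, -, ha, ha', hb, hb', hab⟩, hcol, -⟩ (rfl | rfl)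
      · exact .inl ⟨rfl, opponent_unique heven ⟨ht, ht'⟩ ⟨hb, hb'⟩ hj hab htj (hcol.trans hc.symm)⟩
      · dsimp only at hcol hab
        rw [circleColor_comm] at hcol
        exact .inr ⟨opponent_unique heven ⟨ht, ht'⟩ ⟨ha, ha'⟩ hj hab.symm htj
          (hcol.trans hc.symm), rfl⟩
    by_cases ho : t < j ↔ k ≤ n - 1
    · refine ⟨(k, t, j), ⟨⟨⟨hk, hk', ht, ht', hj.1, hj.2, htj⟩, hc, ho⟩, rfl, .inl rfl⟩, ?_⟩
      rintro ⟨l, a, b⟩ ⟨hm, rfl, hab⟩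
      rcases key a b hm hab with ⟨rfl, rfl⟩ | ⟨rfl, rfl⟩
      · rfl
      · have := hm.2.2
        dsimp only at this ho
        omega
    · refine ⟨(k, j, t), ⟨⟨⟨hk, hk', hj.1, hj.2, ht, ht', htj.symm⟩, ?_, ?_⟩, rfl, .inr rfl⟩, ?_⟩
      · dsimp only
        rw [circleColor_comm]
        exact hc
      · dsimp only
        omega
      rintro ⟨l, a, b⟩ ⟨hm, rfl, hab⟩
      rcases key a b hm hab with ⟨rfl, rfl⟩ | ⟨rfl, rfl⟩
      · exact absurd hm.2.2 ho
      · rfl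
  pair i j hi hi' hj hj' hij := by
    obtain ⟨k, hk, hkc⟩ := exists_modEq_le (N := n - 1) (by omega) (circleColor n i j)
    by_cases ho : i < j
    · refine ⟨k, ⟨⟨hk.1, ?_, hi, hi', hj, hj', hij⟩, hkc.symm, ?_⟩, ?_⟩
      · dsimp only; omega
      · dsimp only; omega
      rintro l ⟨⟨hl, -⟩, hlc, hlo⟩
      dsimp only at hl hlc hlo
      exact eq_of_modEq_of_le (hlc.symm.trans hkc.symm) ⟨hl, hlo.1 ho⟩ hk
    · refine ⟨k + (n - 1), ⟨⟨?_, ?_, hi, hi', hj, hj', hij⟩, ?_, ?_⟩, ?_⟩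
      · dsimp only; omega
      · dsimp only; omega
      · exact hkc.symm.trans (Nat.add_mod_right k (n - 1)).symm
      · dsimp only; omega
      rintro l ⟨⟨hl, hl', -⟩, hlc, hlo⟩
      dsimp only at hl hl' hlc hlo
      obtain ⟨l, rfl⟩ : ∃ l', l = l' + (n - 1) := ⟨l - (n - 1), by omega⟩
      have hlc' : circleColor n i j ≡ l [MOD n - 1] := hlc.trans (Nat.add_mod_right l (n - 1))
      have := eq_of_modEq_of_le (hlc'.symm.trans hkc.symm) (by omega) hk
      omega

/-! ### Tournaments on the face -/

/-- The tournaments `T` for which the minimal point `(χ(T), ψ(T))` satisfies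
`x_{2n-2,i,t} = y_{t,i,t}`. -/
def OnFace (n i t : ℕ) (T : Set (ℕ × ℕ × ℕ)) : Prop :=
  IsTournament n T ∧ ((2 * n - 2, i, t) ∈ T ∨ travel n T (t, i, t) = 0)

lemma mem_reslot {σ : Equiv.Perm ℕ} {k l a b : ℕ} (hσ : σ k = l) (h : (l, a, b) ∈ T) :
    (k, a, b) ∈ reslot σ T := by
  subst hσ; exact h

/-- If `(a, s)` and `(i, t)` are played in different slots, then the slots can be permuted so that
`s` does not travel from `a` to `b` and `(i, t)` is played in the last slot. -/
lemma IsTournament.exists_reslot_of_ne (hT : IsTournament n T) (hn : 4 ≤ n) {i t s a b r r₀ : ℕ}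
    (hr₀ : (r₀, i, t) ∈ T) (hr : (r, a, s) ∈ T) (hne : r ≠ r₀) :
    ∃ T', OnFace n i t T' ∧ travel n T' (s, a, b) = 0 := by
  obtain ⟨hr₁, hr₂, -, -, hs₁, hs₂, has⟩ := hT.subset _ hr
  obtain ⟨hr₀₁, hr₀₂, -⟩ := hT.subset _ hr₀
  dsimp only at *
  obtain ⟨q, c, d, hq₁, hq₂, hq, hcd, hqr, hqr₀, hcb⟩ : ∃ q c d, 1 ≤ q ∧ q ≤ 2 * n - 2 ∧
      (q, c, d) ∈ T ∧ (s = c ∨ s = d) ∧ q ≠ r ∧ q ≠ r₀ ∧ c ≠ b := by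
    by_cases hb : b = s
    · obtain ⟨q, c, h₁, h₂, h₃, h₄, h₅, h₆⟩ := hT.exists_away hn ⟨hs₁, hs₂⟩ r r₀
      exact ⟨q, c, s, h₁, h₂, h₃, .inr rfl, h₅, h₆, by rwa [hb]⟩
    · obtain ⟨q, c, h₁, h₂, h₃, h₄, h₅, h₆⟩ := hT.exists_home hn ⟨hs₁, hs₂⟩ r r₀
      exact ⟨q, s, c, h₁, h₂, h₃, .inl rfl, h₅, h₆, Ne.symm hb⟩
  obtain ⟨σ, hσ, hl⟩ := exists_permutesSlots (2 * n - 2) [(1, r), (2, q), (2 * n - 2, r₀)]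
    (by simp; omega) (by simp; omega) (by simp; omega)
  have hT' := hT.reslot hσ
  refine ⟨TTP.reslot σ T, ⟨hT', .inl (mem_reslot (hl (_, r₀) (by simp)) hr₀)⟩, ?_⟩
  refine hT'.travel_eq_zero_of_next (mem_reslot (hl (1, r) (by simp)) hr) ?_
  rwa [hT'.venue_eq (mem_reslot (hl (2, q) (by simp)) hq) hcd]

/-- Every travel can be avoided by a tournament on the face. -/
lemma exists_onFace_travel_eq_zero (hn : 4 ≤ n) (heven : Even n) {i t s a b : ℕ}
    (hi : 1 ≤ i ∧ i ≤ n) (ht : 1 ≤ t ∧ t ≤ n) (hit : i ≠ t) (h : IsTravelIdx n (s, a, b)) :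
    ∃ T, OnFace n i t T ∧ travel n T (s, a, b) = 0 := by
  obtain ⟨hs₁, hs₂, ha₁, ha₂, hb₁, hb₂, hab⟩ := h
  dsimp only at *
  obtain ⟨T, hT⟩ : ∃ T, IsTournament n T := ⟨_, isTournament_circleSchedule hn heven⟩
  obtain ⟨r₀, hr₀₁, hr₀₂, hr₀⟩ := hT.exists_slot hi ht hit
  by_cases has : a = s
  · subst has
    obtain ⟨r, hr₁, hr₂, hr⟩ := hT.exists_slot ⟨hb₁, hb₂⟩ ⟨ha₁, ha₂⟩ hab.symm
    obtain ⟨q, c, hq₁, hq₂, hq, hca, hqr, hqr₀⟩ := hT.exists_away hn ⟨ha₁, ha₂⟩ r r₀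
    by_cases hne : r = r₀
    · subst hne
      obtain ⟨σ, hσ, hl⟩ := exists_permutesSlots (2 * n - 2)
        [(2 * n - 3, q), (2 * n - 3 + 1, r)] (by simp) (by simp; omega) (by simp; omega)
      have hT' := hT.reslot hσ
      have hlast : 2 * n - 3 + 1 = 2 * n - 2 := by omega
      refine ⟨reslot σ T, ⟨hT', .inl (mem_reslot (l := r) ?_ hr₀)⟩, ?_⟩
      · rw [← hlast]; exact hl (_, _) (by simp)
      refine hT'.travel_eq_zero_of_prev (mem_reslot (hl (2 * n - 3 + 1, r) (by simp)) hr) ?_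
      rwa [hT'.venue_eq (mem_reslot (hl (2 * n - 3, q) (by simp)) hq) (.inr rfl)]
    · obtain ⟨σ, hσ, hl⟩ := exists_permutesSlots (2 * n - 2) [(1, q), (2, r), (2 * n - 2, r₀)]
        (by simp; omega) (by simp; omega) (by simp; omega)
      have hT' := hT.reslot hσ
      refine ⟨reslot σ T, ⟨hT', .inl (mem_reslot (hl (_, r₀) (by simp)) hr₀)⟩, ?_⟩
      refine hT'.travel_eq_zero_of_prev (k := 1) (mem_reslot (hl (2, r) (by simp)) hr) ?_
      rwa [hT'.venue_eq (mem_reslot (hl (1, q) (by simp)) hq) (.inr rfl)]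
  · obtain ⟨r, hr₁, hr₂, hr⟩ := hT.exists_slot ⟨ha₁, ha₂⟩ ⟨hs₁, hs₂⟩ has
    by_cases hne : r = r₀
    · subst hne
      by_cases heq : a = i ∧ s = t
      · obtain ⟨rfl, rfl⟩ := heq
        by_cases hb : b = s
        · subst hb
          obtain ⟨q, c, hq₁, hq₂, hq, hcb, hqr, -⟩ := hT.exists_away hn ⟨hs₁, hs₂⟩ r r
          obtain ⟨σ, hσ, hl⟩ := exists_permutesSlots (2 * n - 2) [(1, r), (2, q)]
            (by simp) (by simp; omega) (by simp; omega)
          have hT' := hT.reslot hσ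
          have h0 : travel n (reslot σ T) (b, a, b) = 0 := by
            refine hT'.travel_eq_zero_of_next (mem_reslot (hl (1, r) (by simp)) hr) ?_
            rwa [hT'.venue_eq (mem_reslot (hl (2, q) (by simp)) hq) (.inr rfl)]
          exact ⟨reslot σ T, ⟨hT', .inr h0⟩, h0⟩
        · obtain ⟨σ, hσ, hl⟩ := exists_permutesSlots (2 * n - 2) [(2 * n - 2, r)]
            (by simp) (by simp) (by simp; omega)
          have hT' := hT.reslot hσ
          have hmem := mem_reslot (hl (2 * n - 2, r) (by simp)) hr
          refine ⟨reslot σ T, ⟨hT', .inl hmem⟩, hT'.travel_eq_zero_of_next hmem ?_⟩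
          rw [hT'.venue_last]
          exact Ne.symm hb
      · obtain ⟨r', -, -, hr'⟩ := hT.exists_slot ⟨hs₁, hs₂⟩ ⟨ha₁, ha₂⟩ (Ne.symm has)
        have hrr' : r' ≠ r := by
          rintro rfl
          exact has (hT.match_unique (s := s) hr hr' (.inr rfl) (.inl rfl)).1
        have hflip : ¬((i = a ∧ t = s) ∨ (i = s ∧ t = a)) := by
          rintro (⟨rfl, rfl⟩ | ⟨rfl, rfl⟩)
          · exact heq ⟨rfl, rfl⟩
          · exact hrr' (hT.slot_unique hr' hr₀)
        refine (hT.flipPair a s).exists_reslot_of_ne hn (r₀ := r) (r := r') ?_ ?_ hrr'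
        · rwa [mem_flipPair, if_neg hflip]
        · rwa [mem_flipPair, if_pos (.inl ⟨rfl, rfl⟩)]
    · exact hT.exists_reslot_of_ne hn hr₀ hr hne

lemma onFace_of_next_away (hT : IsTournament n T) {k i t c : ℕ} (h : (k, i, t) ∈ T)
    (h' : (k + 1, c, t) ∈ T) (hc : c ≠ t) : OnFace n i t T :=
  ⟨hT, .inr (hT.travel_eq_zero_of_next h (by rwa [hT.venue_eq h' (.inr rfl)]))⟩

lemma play_reslot (σ : Equiv.Perm ℕ) (k a b : ℕ) :
    play (reslot σ T) (k, a, b) = play T (σ k, a, b) := rfl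

/-- Exchanging the slots `p` and `q` changes the play vector of `T` in the same way as that of any
rearrangement of `T` fixing `p` and `q`. -/
lemma play_eq_of_fixes {p q : ℕ} {τ : Equiv.Perm ℕ} (hp : τ p = p) (hq : τ q = q)
    (m : ℕ × ℕ × ℕ) :
    play T m = play (reslot (Equiv.swap p q) T) m + play (reslot τ T) m -
      play (reslot (Equiv.swap p q) (reslot τ T)) m := by
  obtain ⟨k, a, b⟩ := m
  simp only [play_reslot]
  by_cases hkp : k = p
  · subst hkp
    rw [Equiv.swap_apply_left, hp, hq]
    ring
  by_cases hkq : k = q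
  · subst hkq
    rw [Equiv.swap_apply_right, hp, hq]
    ring
  rw [Equiv.swap_apply_of_ne_of_ne hkp hkq]
  ring

/-- The play vector of every tournament is an affine combination of play vectors of tournaments
on the face. -/
lemma exists_onFace_play_eq (hT : IsTournament n T) (hn : 4 ≤ n) {i t : ℕ}
    (hi : 1 ≤ i ∧ i ≤ n) (ht : 1 ≤ t ∧ t ≤ n) (hit : i ≠ t) :
    ∃ T₁ T₂ T₃, OnFace n i t T₁ ∧ OnFace n i t T₂ ∧ OnFace n i t T₃ ∧
      ∀ m, play T m = play T₁ m + play T₂ m - play T₃ m := by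
  by_cases hF : OnFace n i t T
  · exact ⟨T, T, T, hF, hF, hF, fun m => by ring⟩
  obtain ⟨k, hk₁, hk₂, hk⟩ := hT.exists_slot hi ht hit
  have hkm : k ≠ 2 * n - 2 := by
    rintro rfl
    exact hF ⟨hT, .inl hk⟩
  have hhome : venue T t (k + 1) = t := by
    by_contra hv
    exact hF ⟨hT, .inr (hT.travel_eq_zero_of_next hk hv)⟩
  have away_ne : ∀ {q c}, (q, c, t) ∈ T → c ≠ t → q ≠ k + 1 := by
    rintro q c hq hc rfl
    exact hc ((hT.venue_eq hq (.inr rfl)).symm.trans hhome)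
  obtain ⟨q, c, hq₁, hq₂, hq, hc, hqk, hqm⟩ := hT.exists_away hn ht k (2 * n - 2)
  have hqk' := away_ne hq hc
  have hswap : PermutesSlots (2 * n - 2) (Equiv.swap (k + 1) q) :=
    permutesSlots_swap (by omega) (by omega)
  have hT₁ := hT.reslot hswap
  have hF₁ : OnFace n i t (reslot (Equiv.swap (k + 1) q) T) :=
    onFace_of_next_away hT₁
      (mem_reslot (Equiv.swap_apply_of_ne_of_ne (by omega) (by omega)) hk)
      (mem_reslot (Equiv.swap_apply_left _ _) hq) hc
  by_cases hlast : k + 1 = 2 * n - 2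
  · obtain ⟨q', c', hq'₁, hq'₂, hq', hc', hq'k, hq'q⟩ := hT.exists_away hn ht k q
    have hq'k' := away_ne hq' hc'
    obtain ⟨p, hp₁, hp₂, hpq, hpq'⟩ : ∃ p, 1 ≤ p ∧ p + 1 < 2 * n - 2 ∧ p ≠ q ∧ p + 1 ≠ q := by
      by_cases h : q ≤ 2
      · exact ⟨3, by omega⟩
      · exact ⟨1, by omega⟩
    obtain ⟨τ, hτ, hl⟩ := exists_permutesSlots (2 * n - 2)
      [(k + 1, k + 1), (q, q), (p, k), (p + 1, q')]
      (by simp; omega) (by simp; omega) (by simp; omega)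
    have hT₂ := hT.reslot hτ
    have h₁ := mem_reslot (hl (p, k) (by simp)) hk
    have h₂ := mem_reslot (hl (p + 1, q') (by simp)) hq'
    refine ⟨_, _, _, hF₁, onFace_of_next_away hT₂ h₁ h₂ hc',
      onFace_of_next_away (hT₂.reslot hswap)
        (mem_reslot (Equiv.swap_apply_of_ne_of_ne (by omega) (by omega)) h₁)
        (mem_reslot (Equiv.swap_apply_of_ne_of_ne (by omega) (by omega)) h₂) hc',
      play_eq_of_fixes (hl (k + 1, k + 1) (by simp)) (hl (q, q) (by simp))⟩
  · have hT₂ := hT.reslot (permutesSlots_swap (m := 2 * n - 2) (p := k) (q := 2 * n - 2)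
      (by omega) (by omega))
    have h₁ := mem_reslot (Equiv.swap_apply_right k (2 * n - 2)) hk
    refine ⟨_, _, _, hF₁, ⟨hT₂, .inl h₁⟩,
      ⟨hT₂.reslot hswap,
        .inl (mem_reslot (Equiv.swap_apply_of_ne_of_ne (by omega) (by omega)) h₁)⟩,
      play_eq_of_fixes ?_ ?_⟩
    · exact Equiv.swap_apply_of_ne_of_ne (by omega) (by omega)
    · exact Equiv.swap_apply_of_ne_of_ne (by omega) (by omega)

/-! ### The polytope and the face -/

instance : Finite {m : ℕ × ℕ × ℕ // IsMatch n m} :=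
  Set.Finite.to_subtype <| ((Set.finite_Iic (2 * n - 2)).prod
    ((Set.finite_Iic n).prod (Set.finite_Iic n))).subset
      fun _ h => ⟨h.2.1, h.2.2.2.1, h.2.2.2.2.2.1⟩

instance : Finite {p : ℕ × ℕ × ℕ // IsTravelIdx n p} :=
  Set.Finite.to_subtype <| ((Set.finite_Iic n).prod
    ((Set.finite_Iic n).prod (Set.finite_Iic n))).subset
      fun _ h => ⟨h.2.1, h.2.2.2.1, h.2.2.2.2.2.1⟩

/-- The vertices of `Ptt n`. -/
def vertices (n : ℕ) : Set (Pt n) :=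
  {z | ∃ T : Set (ℕ × ℕ × ℕ), IsTournament n T ∧
    (∀ m : {m : ℕ × ℕ × ℕ // IsMatch n m}, z.1 m = play T m.1) ∧
    (∀ p : {p : ℕ × ℕ × ℕ // IsTravelIdx n p}, z.2 p = 0 ∨ z.2 p = 1) ∧
    (∀ p : {p : ℕ × ℕ × ℕ // IsTravelIdx n p}, travel n T p.1 ≤ z.2 p)}

/-- The linear functional `x_{2n-2,i,t} - y_{t,i,t}`. -/
noncomputable def slack (n i t : ℕ) (hx : IsMatch n (2 * n - 2, i, t))
    (hy : IsTravelIdx n (t, i, t)) : Pt n →ₗ[ℝ] ℝ :=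
  LinearMap.proj (R := ℝ) (φ := fun _ : {m // IsMatch n m} => ℝ) ⟨_, hx⟩ ∘ₗ LinearMap.fst ℝ _ _ -
    LinearMap.proj (R := ℝ) (φ := fun _ : {p // IsTravelIdx n p} => ℝ) ⟨_, hy⟩ ∘ₗ
      LinearMap.snd ℝ _ _

/-- The point `(χ(T), ψ(T))`. -/
noncomputable def minPoint (n : ℕ) (T : Set (ℕ × ℕ × ℕ)) : Pt n :=
  (fun m => play T m.1, fun p => travel n T p.1)

/-- The unit vector of a travel coordinate. -/
noncomputable def travelUnit (p : {p : ℕ × ℕ × ℕ // IsTravelIdx n p}) : Pt n :=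
  (0, Pi.single p 1)

lemma travel_eq_zero_or_one (p : ℕ × ℕ × ℕ) : travel n T p = 0 ∨ travel n T p = 1 := by
  unfold travel
  split_ifs <;> simp

lemma minPoint_mem_vertices (hT : IsTournament n T) : minPoint n T ∈ vertices n :=
  ⟨T, hT, fun _ => rfl, fun _ => travel_eq_zero_or_one _, fun _ => le_rfl⟩

lemma minPoint_add_travelUnit_mem_vertices (hT : IsTournament n T)
    {p : {p : ℕ × ℕ × ℕ // IsTravelIdx n p}} (hp : travel n T p.1 = 0) :
    minPoint n T + travelUnit p ∈ vertices n := by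
  refine ⟨T, hT, fun m => by simp [minPoint, travelUnit], fun q => ?_, fun q => ?_⟩
  · by_cases h : q = p
    · subst h
      simp [minPoint, travelUnit, hp]
    · simpa [minPoint, travelUnit, h] using travel_eq_zero_or_one _
  · by_cases h : q = p
    · subst h
      simp [minPoint, travelUnit, hp]
    · simp [minPoint, travelUnit, h]

section Face

variable {i t : ℕ} (hx : IsMatch n (2 * n - 2, i, t)) (hy : IsTravelIdx n (t, i, t))

lemma slack_apply (z : Pt n) : slack n i t hx hy z = z.1 ⟨_, hx⟩ - z.2 ⟨_, hy⟩ := rfl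

lemma slack_eq (z : Pt n) : slack n i t hx hy z = xval z (2 * n - 2) i t - yval z t i t := by
  rw [slack_apply, xval, yval, dif_pos hx, dif_pos hy]

lemma slack_nonpos {z : Pt n} (hz : z ∈ Ptt n) : slack n i t hx hy z ≤ 0 := by
  refine convexHull_min ?_ (convex_halfSpace_le (slack n i t hx hy).isLinear 0) hz
  rintro z ⟨T, hT, h₁, h₂, h₃⟩
  rw [Set.mem_ofPred_eq, slack_apply, h₁, play]
  split_ifs with h
  · have := h₃ ⟨_, hy⟩
    rw [hT.travel_last h] at this
    linarith
  · rcases h₂ ⟨_, hy⟩ with h | h <;> rw [h] <;> norm_num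

lemma slack_minPoint (hT : OnFace n i t T) : slack n i t hx hy (minPoint n T) = 0 := by
  rw [slack_apply, sub_eq_zero]
  change play T _ = travel n T _
  rcases hT with ⟨hT, h | h⟩
  · rw [hT.travel_last h, play, if_pos h]
  · rw [h, play, if_neg]
    intro h'
    rw [hT.travel_last h'] at h
    exact one_ne_zero h

lemma slack_travelUnit_of_ne {p : {p : ℕ × ℕ × ℕ // IsTravelIdx n p}} (hp : p ≠ ⟨_, hy⟩) :
    slack n i t hx hy (travelUnit p) = 0 := by
  simp [slack_apply, travelUnit, hp.symm]

lemma slack_travelUnit_self : slack n i t hx hy (travelUnit ⟨_, hy⟩) = -1 := by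
  simp [slack_apply, travelUnit]

/-- The face of `Ptt n` given by `x_{2n-2,i,t} = y_{t,i,t}`. -/
def face : Set (Pt n) := {z ∈ Ptt n | slack n i t hx hy z = 0}

lemma minPoint_mem_face (hT : OnFace n i t T) : minPoint n T ∈ face hx hy :=
  ⟨subset_convexHull ℝ _ (minPoint_mem_vertices hT.1), slack_minPoint hx hy hT⟩

lemma vectorSpan_face_le_ker : vectorSpan ℝ (face hx hy) ≤ LinearMap.ker (slack n i t hx hy) := by
  rw [vectorSpan_def, Submodule.span_le]
  rintro _ ⟨z, hz, w, hw, rfl⟩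
  simp only [vsub_eq_sub, SetLike.mem_coe, LinearMap.mem_ker, map_sub]
  rw [hz.2, hw.2, sub_zero]

lemma travelUnit_mem_vectorSpan_face (hn : 4 ≤ n) (heven : Even n)
    {p : {p : ℕ × ℕ × ℕ // IsTravelIdx n p}} (hp : p ≠ ⟨_, hy⟩) :
    travelUnit p ∈ vectorSpan ℝ (face hx hy) := by
  obtain ⟨hi₁, hi₂, ht₁, ht₂, hit⟩ := hx.2.2
  obtain ⟨T, hT, h0⟩ := exists_onFace_travel_eq_zero hn heven ⟨hi₁, hi₂⟩ ⟨ht₁, ht₂⟩ hit p.2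
  rw [← add_sub_cancel_left (minPoint n T) (travelUnit p)]
  refine vsub_mem_vectorSpan ℝ ⟨subset_convexHull ℝ _ ?_, ?_⟩ (minPoint_mem_face _ hy hT)
  · exact minPoint_add_travelUnit_mem_vertices hT.1 h0
  · rw [map_add, slack_minPoint _ hy hT, slack_travelUnit_of_ne _ hy hp, add_zero]

lemma travelUnit_mem_vectorSpan_Ptt (hn : 4 ≤ n) (heven : Even n)
    (p : {p : ℕ × ℕ × ℕ // IsTravelIdx n p}) :
    travelUnit p ∈ vectorSpan ℝ (Ptt n) := by
  obtain ⟨T, hT, h0⟩ := exists_onFace_travel_eq_zero (i := 1) (t := 2) hn heven (by omega)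
    (by omega) (by omega) p.2
  rw [← add_sub_cancel_left (minPoint n T) (travelUnit p)]
  exact vsub_mem_vectorSpan ℝ
    (subset_convexHull ℝ _ (minPoint_add_travelUnit_mem_vertices hT.1 h0))
    (subset_convexHull ℝ _ (minPoint_mem_vertices hT.1))

lemma vectorSpan_Ptt_eq (hn : 4 ≤ n) (heven : Even n) :
    vectorSpan ℝ (Ptt n) = vectorSpan ℝ (face hx hy) ⊔ ℝ ∙ travelUnit ⟨_, hy⟩ := by
  set W := vectorSpan ℝ (face hx hy) ⊔ ℝ ∙ travelUnit ⟨_, hy⟩ with hW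
  refine le_antisymm ?_ (sup_le (vectorSpan_mono ℝ fun z hz => hz.1) ?_)
  · have hle : vectorSpan ℝ (face hx hy) ≤ W := le_sup_left
    have hunit : ∀ p, travelUnit p ∈ W := by
      intro p
      by_cases hp : p = ⟨_, hy⟩
      · subst hp
        exact le_sup_right (a := vectorSpan ℝ (face hx hy)) (Submodule.mem_span_singleton_self _)
      · exact hle (travelUnit_mem_vectorSpan_face hx hy hn heven hp)
    have hsnd : ∀ y, ((0, y) : Pt n) ∈ W := by
      intro y
      have : Fintype {p : ℕ × ℕ × ℕ // IsTravelIdx n p} := Fintype.ofFinite _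
      have hsum : ((0, y) : Pt n) = ∑ p, y p • travelUnit p := by
        ext q
        · simp [Prod.fst_sum, travelUnit]
        · simp [Prod.snd_sum, travelUnit, Finset.sum_apply, Pi.single_apply]
      rw [hsum]
      exact W.sum_mem fun p _ => W.smul_mem _ (hunit p)
    have hfst : ∀ {z w : Pt n}, z.1 = w.1 → w ∈ W → z ∈ W := by
      intro z w h hw
      have : z = w + (0, z.2 - w.2) := by ext <;> simp [h]
      rw [this]
      exact W.add_mem hw (hsnd _)
    obtain ⟨hi₁, hi₂, ht₁, ht₂, hit⟩ := hx.2.2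
    obtain ⟨T₀, hT₀, -⟩ := exists_onFace_travel_eq_zero hn heven ⟨hi₁, hi₂⟩ ⟨ht₁, ht₂⟩ hit hy
    have hz₀ := minPoint_mem_face hx hy hT₀
    have hdiff : ∀ {T T'}, OnFace n i t T → OnFace n i t T' →
        minPoint n T - minPoint n T' ∈ W := fun hT hT' =>
      hle (vsub_mem_vectorSpan ℝ (minPoint_mem_face hx hy hT) (minPoint_mem_face hx hy hT'))
    have hspan : vectorSpan ℝ (Ptt n) = vectorSpan ℝ (vertices n) := by
      rw [← direction_affineSpan, ← direction_affineSpan]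
      exact congrArg _ (affineSpan_convexHull (vertices n))
    rw [hspan, vectorSpan_eq_span_vsub_set_right ℝ (minPoint_mem_vertices hT₀.1),
      Submodule.span_le]
    rintro _ ⟨z, ⟨T, hT, hz, -, -⟩, rfl⟩
    obtain ⟨T₁, T₂, T₃, h₁, h₂, h₃, h⟩ :=
      exists_onFace_play_eq hT hn ⟨hi₁, hi₂⟩ ⟨ht₁, ht₂⟩ hit
    refine hfst ?_ (W.add_mem (hdiff h₁ hT₀) (hdiff h₂ h₃))
    ext m
    simp only [vsub_eq_sub, Prod.fst_sub, Prod.fst_add, Pi.sub_apply, Pi.add_apply, hz, h, minPoint]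
    ring
  · rw [Submodule.span_singleton_le_iff_mem]
    exact travelUnit_mem_vectorSpan_Ptt hn heven _

end Face

end

/-- the inequalities `x_{2n-2,i,t} ≤ y_{t,i,t}` are facet-defining. -/
theorem travel_last_facet (n : ℕ) (hn : 4 ≤ n) (heven : Even n)
    (i t : ℕ) (hi1 : 1 ≤ i) (hin : i ≤ n) (ht1 : 1 ≤ t) (htn : t ≤ n) (hit : i ≠ t) :
    IsFacetLE (fun z : Pt n => xval z (2 * n - 2) i t - yval z t i t) 0 := by
  have hx : IsMatch n (2 * n - 2, i, t) := ⟨by dsimp only; omega, le_rfl, hi1, hin, ht1, htn, hit⟩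
  have hy : IsTravelIdx n (t, i, t) := ⟨ht1, htn, hi1, hin, ht1, htn, hit⟩
  simp only [← slack_eq hx hy]
  refine ⟨fun z => slack_nonpos hx hy, ?_⟩
  change adim (face hx hy) + 1 = _
  have hnot : travelUnit ⟨_, hy⟩ ∉ vectorSpan ℝ (face hx hy) := by
    intro h
    have := vectorSpan_face_le_ker hx hy h
    rw [LinearMap.mem_ker, slack_travelUnit_self] at this
    norm_num at this
  rw [adim, adim, direction_affineSpan, direction_affineSpan, vectorSpan_Ptt_eq hx hy hn heven]
  exact (Submodule.finrank_sup_span_singleton hnot).symm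

end TTP
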